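/- Let α be a type-B composition of n and let π, σ, π' ∈ H_α with Inv(π) ⊆ Inv(σ) ⊆ Inv(π'). If Π↓(π) = Π↓(π'), then Π↓(σ) = Π↓(π). -/

import Mathlib

namespace TypeB

/-- A sign-symmetric permutation of degree `n`: a bijection of `ℤ` with
`π(-i) = -π(i)` which fixes every integer of absolute value `> n`.
It restricts to a sign-symmetric permutation of `±[n]`. -/
structure SignedPerm (n : ℕ) where
  perm : Equiv.Perm ℤ
  sign_symm : ∀ i : ℤ, perm (-i) = - perm i
  outside : ∀ i : ℤ, (n : ℤ) < |i| → perm i = i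

/-- Symbols for type-B inversions: `neg i` is `[i]`, `pair i j` (with `i < j`)
is `(i,j)`, and `mixed i j` (with `i < j`) is `(−j, i)`. -/
inductive BInv (n : ℕ) : Type where
  | neg : ℕ → BInv n
  | pair : ℕ → ℕ → BInv n
  | mixed : ℕ → ℕ → BInv n
deriving DecidableEq

/-- `i⁺`: `i+1` if `i ≠ -1`, and `1` for `i = -1`. -/
def iplus (i : ℤ) : ℤ := if i = -1 then 1 else i + 1

/-- The inversion set of a sign-symmetric permutation. -/
def Inv {n : ℕ} (π : SignedPerm n) : Set (BInv n) := fun t =>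
  match t with
  | .neg i => 1 ≤ i ∧ i ≤ n ∧ π.perm (i : ℤ) < 0
  | .pair i j => 1 ≤ i ∧ i < j ∧ j ≤ n ∧ π.perm (j : ℤ) < π.perm (i : ℤ)
  | .mixed i j => 1 ≤ i ∧ i < j ∧ j ≤ n ∧ π.perm (i : ℤ) + π.perm (j : ℤ) < 0

/-- The cover-inversion set of a sign-symmetric permutation. -/
def Cov {n : ℕ} (π : SignedPerm n) : Set (BInv n) := fun t =>
  match t with
  | .neg i => 1 ≤ i ∧ i ≤ n ∧ π.perm (i : ℤ) = -1
  | .pair i j => 1 ≤ i ∧ i < j ∧ j ≤ n ∧ π.perm (i : ℤ) = iplus (π.perm (j : ℤ))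
  | .mixed i j => 1 ≤ i ∧ i < j ∧ j ≤ n ∧ π.perm (-(j : ℤ)) = iplus (π.perm (i : ℤ))

/-- The symbol `(−j, i)` in canonical form (it equals `(−i, j)`). -/
def mixedInv {n : ℕ} (i j : ℕ) : BInv n := .mixed (min i j) (max i j)

/-- A type-B composition of `n`: positive parts summing to `n`,
together with a split/join label. -/
structure BComp (n : ℕ) where
  parts : List ℕ
  pos : ∀ a ∈ parts, 0 < a
  sum_eq : parts.sum = n
  isJoin : Bool

/-- The partial sum `p_i = α₁ + ⋯ + α_i`. -/
def pSum {n : ℕ} (α : BComp n) (i : ℕ) : ℕ := (α.parts.take i).sum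

/-- The α-region of `a ∈ [n]`: the unique `i` with `p_{i-1} < a ≤ p_i`. -/
def region {n : ℕ} (α : BComp n) (a : ℕ) : ℕ :=
  ((Finset.range α.parts.length).filter (fun j => pSum α j < a)).card

/-- The first part `α₁` of a type-B composition. -/
def alpha1 {n : ℕ} (α : BComp n) : ℕ := α.parts.headI

/-- Index of the block of `Part(α)` containing `x ∈ ±[n]`; two elements lie in
a common block of `Part(α)` iff their indices agree. -/
def blockIdx {n : ℕ} (α : BComp n) (x : ℤ) : ℤ :=
  if 0 < x then
    (if α.isJoin = true ∧ region α x.toNat = 1 then 0 else (region α x.toNat : ℤ))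
  else
    (if α.isJoin = true ∧ region α (-x).toNat = 1 then 0 else -(region α (-x).toNat : ℤ))

/-- Membership in `±[n]`. -/
def inPM (n : ℕ) (x : ℤ) : Prop := x ≠ 0 ∧ -(n : ℤ) ≤ x ∧ x ≤ (n : ℤ)

/-- `π ∈ H_α`: `π` is increasing on every block of `Part(α)`. -/
def memH {n : ℕ} (α : BComp n) (π : SignedPerm n) : Prop :=
  ∀ a b : ℤ, inPM n a → inPM n b → a < b → blockIdx α a = blockIdx α b →
    π.perm a < π.perm b

/-- Common part of the type-B `(α,231)`- and `(α,312)`-patterns: indices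
`i < j < k` in `±[n]`, in pairwise distinct blocks of `Part(α)`, with `j > 0`
and `π(i) = π(k)⁺`. -/
def patternCore {n : ℕ} (α : BComp n) (π : SignedPerm n) (i j k : ℤ) : Prop :=
  inPM n i ∧ inPM n j ∧ inPM n k ∧ i < j ∧ j < k ∧ 0 < j ∧
  blockIdx α i ≠ blockIdx α j ∧ blockIdx α j ≠ blockIdx α k ∧
  blockIdx α i ≠ blockIdx α k ∧ π.perm i = iplus (π.perm k)

/-- `π` has a type-B `(α,231)`-split (resp. -join) pattern, according to the
label of `α`. -/
def has231 {n : ℕ} (α : BComp n) (π : SignedPerm n) : Prop :=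
  ∃ i j k : ℤ, patternCore α π i j k ∧
    (if α.isJoin = true then
       (((alpha1 α : ℤ) < j → π.perm i < π.perm j) ∧
        (j ≤ (alpha1 α : ℤ) → π.perm j < π.perm k))
     else π.perm i < π.perm j)

/-- `π` has a type-B `(α,312)`-split (resp. -join) pattern, according to the
label of `α`. -/
def has312 {n : ℕ} (α : BComp n) (π : SignedPerm n) : Prop :=
  ∃ i j k : ℤ, patternCore α π i j k ∧
    (if α.isJoin = true then
       (((alpha1 α : ℤ) < j → π.perm j < π.perm k) ∧
        (j ≤ (alpha1 α : ℤ) → π.perm i < π.perm j))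
     else π.perm j < π.perm k)

/-- `π ∈ H_α(231)`. -/
def mem231 {n : ℕ} (α : BComp n) (π : SignedPerm n) : Prop := memH α π ∧ ¬ has231 α π

/-- `π ∈ H_α(312)`. -/
def mem312 {n : ℕ} (α : BComp n) (π : SignedPerm n) : Prop := memH α π ∧ ¬ has312 α π

/-- The set `H_α`. -/
def Hset {n : ℕ} (α : BComp n) : Set (SignedPerm n) := {π | memH α π}

/-- The carrier of `Tam_B(α)`, namely `H_α(231)`. -/
def Tset {n : ℕ} (α : BComp n) : Set (SignedPerm n) := {π | mem231 α π}

/-- The weak order: inclusion of inversion sets. -/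
def wle {n : ℕ} (π σ : SignedPerm n) : Prop := Inv π ⊆ Inv σ

/-- `m` is the greatest lower bound of `x` and `y` within `P`, w.r.t. the weak order. -/
def isMeetIn {n : ℕ} (P : Set (SignedPerm n)) (x y m : SignedPerm n) : Prop :=
  m ∈ P ∧ wle m x ∧ wle m y ∧ ∀ z ∈ P, wle z x → wle z y → wle z m

/-- `u` is the least upper bound of `x` and `y` within `P`, w.r.t. the weak order. -/
def isJoinIn {n : ℕ} (P : Set (SignedPerm n)) (x y u : SignedPerm n) : Prop :=
  u ∈ P ∧ wle x u ∧ wle y u ∧ ∀ z ∈ P, wle x z → wle y z → wle u z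

/-- `d = Π↓(π)`: `d` is the greatest element of `{σ ∈ H_α(231) : Inv σ ⊆ Inv π}`. -/
def isProjDown {n : ℕ} (α : BComp n) (π d : SignedPerm n) : Prop :=
  mem231 α d ∧ wle d π ∧ ∀ σ, mem231 α σ → wle σ π → wle σ d

/-- `d = Π†(π)`: `d` is the greatest element of `{σ ∈ H_α(312) : Inv σ ⊆ Inv π}`. -/
def isProjDagger {n : ℕ} (α : BComp n) (π d : SignedPerm n) : Prop :=
  mem312 α d ∧ wle d π ∧ ∀ σ, mem312 α σ → wle σ π → wle σ d

/-- The value `ω_{o;α}(a)` for `a ∈ [n]`. -/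
def omegaPos {n : ℕ} (α : BComp n) (a : ℕ) : ℤ :=
  if α.isJoin = true ∧ region α a = 1 then (a : ℤ)
  else -(((pSum α (region α a) : ℤ) + (pSum α (region α a - 1) : ℤ) + 1) - (a : ℤ))

/-- The longest element `ω_{o;α}` of `H_α`, as a function on `ℤ`. -/
def omegaFun {n : ℕ} (α : BComp n) (x : ℤ) : ℤ :=
  if 0 < x ∧ x ≤ (n : ℤ) then omegaPos α x.toNat
  else if 0 < -x ∧ -x ≤ (n : ℤ) then -(omegaPos α (-x).toNat)
  else x

/-- The set of `m` such that there is a strict chain `x₀ < x₁ < ⋯ < x_m` in `P`. -/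
def chainLengths {n : ℕ} (P : Set (SignedPerm n)) : Set ℕ :=
  {m | ∃ f : Fin (m + 1) → SignedPerm n, (∀ i, f i ∈ P) ∧
        ∀ i j : Fin (m + 1), i < j → Inv (f i) ⊂ Inv (f j)}

/-- `x` is join-irreducible in `Tam_B(α)`. -/
def joinIrred {n : ℕ} (α : BComp n) (x : SignedPerm n) : Prop :=
  x ∈ Tset α ∧ ¬ (∀ y ∈ Tset α, wle x y) ∧
  ∀ y z, y ∈ Tset α → z ∈ Tset α → isJoinIn (Tset α) y z x → x = y ∨ x = z

/-- `x` is meet-irreducible in `Tam_B(α)`. -/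
def meetIrred {n : ℕ} (α : BComp n) (x : SignedPerm n) : Prop :=
  x ∈ Tset α ∧ ¬ (∀ y ∈ Tset α, wle y x) ∧
  ∀ y z, y ∈ Tset α → z ∈ Tset α → isMeetIn (Tset α) y z x → x = y ∨ x = z

/-- `x` is left modular in the lattice on `P`: `(r ∨ x) ∧ q = r ∨ (x ∧ q)`
for all `r ≤ q` in `P`. -/
def leftModular {n : ℕ} (P : Set (SignedPerm n)) (x : SignedPerm n) : Prop :=
  ∀ r q, r ∈ P → q ∈ P → wle r q →
    ∀ u v w1 w2, isJoinIn P r x u → isMeetIn P u q v →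
      isMeetIn P x q w1 → isJoinIn P r w1 w2 → v = w2

/-- The simple generator `s_i` as a function on `ℤ`: `s₀` exchanges `1` and `-1`,
and for `i ≥ 1`, `s_i` exchanges `i` with `i+1` and `-i` with `-(i+1)`. -/
def sfun (i : ℕ) (x : ℤ) : ℤ :=
  if i = 0 then (if x = 1 then -1 else if x = -1 then 1 else x)
  else if x = (i : ℤ) then (i : ℤ) + 1
  else if x = (i : ℤ) + 1 then (i : ℤ)
  else if x = -(i : ℤ) then -(i : ℤ) - 1
  else if x = -(i : ℤ) - 1 then -(i : ℤ)
  else x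

/-- `i` is one of the partial sums `p₁, …, p_{r−1}` of `α`. -/
def isPSum {n : ℕ} (α : BComp n) (i : ℕ) : Prop :=
  ∃ j : ℕ, 1 ≤ j ∧ j < α.parts.length ∧ pSum α j = i

/-- `n² − Σᵢ α_i(α_i−1)/2`, minus additionally `(α₁+1)α₁/2` when `α` is join. -/
def lengthFormula {n : ℕ} (α : BComp n) : ℕ :=
  n ^ 2 - (α.parts.map (fun a => a * (a - 1) / 2)).sum -
    (if α.isJoin = true then (alpha1 α + 1) * alpha1 α / 2 else 0)

namespace SignedPerm

variable {n : ℕ}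

theorem ext_perm {π σ : SignedPerm n} (h : ∀ x, π.perm x = σ.perm x) : π = σ := by
  cases π
  cases σ
  congr
  exact Equiv.ext h

theorem perm_zero (π : SignedPerm n) : π.perm 0 = 0 := by
  have := π.sign_symm 0
  rw [neg_zero] at this
  omega

theorem abs_perm_le (π : SignedPerm n) {i : ℤ} (hi : |i| ≤ n) : |π.perm i| ≤ n := by
  by_contra! h
  rw [π.perm.injective (π.outside _ h)] at h
  omega

theorem perm_neg_iff_of_inv_eq {π σ : SignedPerm n} (h : Inv π = Inv σ) {i : ℤ} (hi : 0 < i) :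
    π.perm i < 0 ↔ σ.perm i < 0 := by
  lift i to ℕ using hi.le
  rcases le_or_gt i n with hin | hin
  · have key : (BInv.neg i : BInv n) ∈ Inv π ↔ (BInv.neg i : BInv n) ∈ Inv σ := by rw [h]
    change (1 ≤ i ∧ i ≤ n ∧ _) ↔ (1 ≤ i ∧ i ≤ n ∧ _) at key
    have : 1 ≤ i := by omega
    tauto
  · have hi' : (n : ℤ) < |(i : ℤ)| := by rw [abs_of_pos hi]; omega
    rw [π.outside _ hi', σ.outside _ hi']

theorem pair_mixed_iff_of_inv_eq {π σ : SignedPerm n} (h : Inv π = Inv σ) {i j : ℤ} (hi : 0 < i)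
    (hij : i < j) :
    (π.perm j < π.perm i ↔ σ.perm j < σ.perm i) ∧
      (π.perm i + π.perm j < 0 ↔ σ.perm i + σ.perm j < 0) := by
  lift i to ℕ using hi.le
  lift j to ℕ using (hi.trans hij).le
  rcases le_or_gt j n with hjn | hjn
  · have hp : (BInv.pair i j : BInv n) ∈ Inv π ↔ (BInv.pair i j : BInv n) ∈ Inv σ := by rw [h]
    have hm : (BInv.mixed i j : BInv n) ∈ Inv π ↔ (BInv.mixed i j : BInv n) ∈ Inv σ := by rw [h]
    change (1 ≤ i ∧ i < j ∧ j ≤ n ∧ _) ↔ (1 ≤ i ∧ i < j ∧ j ≤ n ∧ _) at hp hm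
    have h1 : 1 ≤ i := by omega
    have h2 : i < j := by omega
    tauto
  · have hj' : (n : ℤ) < |(j : ℤ)| := by rw [abs_of_pos (hi.trans hij)]; omega
    rw [π.outside _ hj', σ.outside _ hj']
    rcases le_or_gt i n with hin | hin
    · have hi' : |(i : ℤ)| ≤ n := by rw [abs_of_pos hi]; omega
      have h1 := abs_le.mp (π.abs_perm_le hi')
      have h2 := abs_le.mp (σ.abs_perm_le hi')
      omega
    · have hi' : (n : ℤ) < |(i : ℤ)| := by rw [abs_of_pos hi]; omega
      rw [π.outside _ hi', σ.outside _ hi']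
      simp

theorem perm_lt_perm_of_inv_eq {π σ : SignedPerm n} (h : Inv π = Inv σ) {a b : ℤ}
    (hab : π.perm a < π.perm b) : σ.perm a < σ.perm b := by
  have hne : a ≠ b := by rintro rfl; exact lt_irrefl _ hab
  have hπ := π.perm_zero
  have hσ := σ.perm_zero
  have := σ.sign_symm a
  have := σ.sign_symm b
  have := π.sign_symm a
  have := π.sign_symm b
  have := σ.perm.injective.eq_iff (a := a) (b := b)
  have := σ.perm.injective.eq_iff (a := a) (b := -b)
  have := σ.perm.injective.eq_iff (a := a) (b := 0)
  have := σ.perm.injective.eq_iff (a := b) (b := 0)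
  have := π.perm.injective.eq_iff (a := a) (b := -b)
  have := π.perm.injective.eq_iff (a := a) (b := 0)
  have := π.perm.injective.eq_iff (a := b) (b := 0)
  have s {x : ℤ} := @perm_neg_iff_of_inv_eq n π σ h x
  have p {x y : ℤ} := @pair_mixed_iff_of_inv_eq n π σ h x y
  have := @s a
  have := @s b
  have := @s (-a)
  have := @s (-b)
  have := @p a b
  have := @p b a
  have := @p (-a) b
  have := @p b (-a)
  have := @p a (-b)
  have := @p (-b) a
  have := @p (-a) (-b)
  have := @p (-b) (-a)
  clear s p
  rcases lt_trichotomy a 0 with ha | ha | ha <;> rcases lt_trichotomy b 0 with hb | hb | hb <;>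
    grind

theorem le_of_strictMono {f : ℤ → ℤ} (hf : StrictMono f) (h0 : f 0 = 0) {x : ℤ} (hx : 0 ≤ x) :
    x ≤ f x := by
  induction x, hx using Int.leInduction with
  | base => exact h0.ge
  | succ k _ ih => have := hf (lt_add_one k); omega

theorem perm_le_perm_of_inv_eq {π σ : SignedPerm n} (h : Inv π = Inv σ) {x : ℤ}
    (hx : 0 ≤ π.perm x) : π.perm x ≤ σ.perm x := by
  have hf : StrictMono fun y => σ.perm (π.perm.symm y) := fun y z hyz =>
    perm_lt_perm_of_inv_eq h (by simpa using hyz)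
  have h0 : π.perm.symm 0 = 0 := by rw [Equiv.symm_apply_eq, perm_zero]
  simpa using le_of_strictMono hf (by simp [h0, perm_zero]) hx

theorem inv_injective : Function.Injective (Inv : SignedPerm n → Set (BInv n)) := by
  intro π σ h
  have key {x : ℤ} (hx : 0 ≤ π.perm x) : π.perm x = σ.perm x := by
    have h1 := perm_le_perm_of_inv_eq h hx
    exact le_antisymm h1 (perm_le_perm_of_inv_eq h.symm (hx.trans h1))
  refine ext_perm fun x => ?_
  rcases le_total 0 (π.perm x) with hx | hx
  · exact key hx
  · have h1 := @key (-x) (by rw [π.sign_symm]; omega)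
    rw [π.sign_symm, σ.sign_symm] at h1
    omega

end SignedPerm

/-- If `π, σ, π' ∈ H_α` with
`Inv(π) ⊆ Inv(σ) ⊆ Inv(π')` and `Π↓(π) = Π↓(π')`, then `Π↓(σ) = Π↓(π)`. -/
theorem projDown_order_convex (n : ℕ) (hn : 1 ≤ n) (α : BComp n)
    (π σ π' : SignedPerm n) (hπ : memH α π) (hσ : memH α σ) (hπ' : memH α π')
    (h1 : Inv π ⊆ Inv σ) (h2 : Inv σ ⊆ Inv π')
    (d : SignedPerm n) (hd : isProjDown α π d) (hd' : isProjDown α π' d)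
    (e : SignedPerm n) (he : isProjDown α σ e) :
    e = d := by
  exact SignedPerm.inv_injective (Set.Subset.antisymm
    (hd'.2.2 e he.1 (he.2.1.trans h2)) (he.2.2 d hd.1 (hd.2.1.trans h1)))

end TypeB
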